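/- arXiv:1810.06248 — 3 statements merged into one kernel-verified Lean document; each statement's English description precedes it below -/
import Mathlib

section
/- Let G₁ be the simple graph on vertex set {1,…,8} with edge set E₁ = {{1,7},{1,2},{2,3},{3,4},{4,5},{5,6},{6,7},{7,8},{2,8},{2,5},{5,8}}. For a subset S ⊆ E₁, let r(S) = 8 − c(S), where c(S) is the number of connected components of the spanning subgraph (V,S). Then the Tutte polynomial T_{G₁}(x,y) = Σ_{S ⊆ E₁} (x−1)^{r(E₁)−r(S)} (y−1)^{|S|−r(S)} equals x⁷ + 4x⁶ + x⁵y + 9x⁵ + 6x⁴y + 3x³y² + x²y³ + 13x⁴ + 13x³y + 7x²y² + 3xy³ + y⁴ + 12x³ + 15x²y + 9xy² + 3y³ + 7x² + 9xy + 4y² + 2x + 2y as a polynomial in ℚ[x,y] (equivalently ℤ[x,y]). -/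
open Finset SimpleGraph MvPolynomial

/-- Edge set of the first Schwärzler graph `G₁` on vertices `{1,…,8}`,
encoded on `Fin 8` via `i ↦ i - 1`. -/
def E1 : Finset (Sym2 (Fin 8)) :=
  {s(0,6), s(0,1), s(1,2), s(2,3), s(3,4), s(4,5), s(5,6), s(6,7), s(1,7), s(1,4), s(4,7)}

/-- Edge set of the second Schwärzler graph `G₂` on vertices `{1,…,8}`,
encoded on `Fin 8` via `i ↦ i - 1`. -/
def E2 : Finset (Sym2 (Fin 8)) :=
  {s(0,6), s(0,1), s(1,3), s(3,4), s(4,6), s(6,7), s(1,7), s(1,4), s(2,4), s(2,5), s(5,7)}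

/-- The number of connected components of the spanning subgraph of the complete
graph on `Fin 8` with edge set `S`. -/
noncomputable def numComp (S : Finset (Sym2 (Fin 8))) : ℕ :=
  Nat.card (SimpleGraph.fromEdgeSet (↑S : Set (Sym2 (Fin 8)))).ConnectedComponent

/-- The (matroid) rank of an edge subset `S`: `8` minus the number of connected
components of the spanning subgraph `(V, S)`. -/
noncomputable def rk (S : Finset (Sym2 (Fin 8))) : ℕ := 8 - numComp S

instance (s : Set (Sym2 (Fin 8))) [DecidablePred (· ∈ s)] :
    DecidableRel (SimpleGraph.fromEdgeSet s).Adj := fun a b =>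
  decidable_of_iff (s(a, b) ∈ s ∧ a ≠ b) (SimpleGraph.fromEdgeSet_adj s).symm

namespace SpanningSubgraph

variable {n : ℕ}

/-- The vertex labels after the classes of `e.1` and `e.2` have been identified. -/
def merge (L : List ℕ) (e : Fin n × Fin n) : List ℕ :=
  L.map fun c => if c = L.getD e.1 0 then L.getD e.2 0 else c

/-- `L` assigns a label to each vertex so that two vertices have equal labels exactly
when they are connected by edges of `S`. -/
def IsLabelling (L : List ℕ) (S : Finset (Sym2 (Fin n))) : Prop :=
  L.length = n ∧ ∀ u v : Fin n,
    L.getD u 0 = L.getD v 0 ↔ (fromEdgeSet (S : Set (Sym2 (Fin n)))).Reachable u v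

lemma getD_merge {L : List ℕ} (hL : L.length = n) (e : Fin n × Fin n) (u : Fin n) :
    (merge L e).getD u 0 =
      if L.getD u 0 = L.getD e.1 0 then L.getD e.2 0 else L.getD u 0 := by
  have hu : (u : ℕ) < L.length := hL ▸ u.2
  simp [merge, List.getD_eq_getElem?_getD, List.getElem?_map, List.getElem?_eq_getElem hu]

lemma isLabelling_range : IsLabelling (List.range n) (∅ : Finset (Sym2 (Fin n))) := by
  refine ⟨List.length_range, fun u v => ?_⟩
  simp [List.getD_eq_getElem?_getD, Fin.ext_iff]

lemma IsLabelling.merge {L : List ℕ} {S : Finset (Sym2 (Fin n))} (h : IsLabelling L S)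
    (e : Fin n × Fin n) : IsLabelling (merge L e) (insert s(e.1, e.2) S) := by
  obtain ⟨hlen, hL⟩ := h
  obtain ⟨a, b⟩ := e
  refine ⟨by simp [SpanningSubgraph.merge, hlen], fun u v => ?_⟩
  have hab : (fromEdgeSet (↑(insert s(a, b) S) : Set (Sym2 (Fin n)))).Reachable a b := by
    by_cases h : a = b
    · rw [h]
    · exact Adj.reachable (by simp [h])
  have mono {u v : Fin n} (h : L.getD u 0 = L.getD v 0) :
      (fromEdgeSet (↑(insert s(a, b) S) : Set (Sym2 (Fin n)))).Reachable u v :=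
    ((hL u v).1 h).mono (fromEdgeSet_mono (by simp))
  rw [getD_merge hlen, getD_merge hlen]
  constructor
  · intro h
    split_ifs at h with hu hv hv
    · exact mono (hu.trans hv.symm)
    · exact (mono hu).trans (hab.trans (mono h))
    · exact (mono h).trans (hab.symm.trans (mono hv.symm))
    · exact mono h
  · rintro ⟨w⟩
    induction w with
    | nil => rfl
    | cons h _ ih =>
      refine Eq.trans ?_ ih
      obtain ⟨h, hne⟩ := (fromEdgeSet_adj _).1 h
      rw [mem_coe, mem_insert, Sym2.eq_iff] at h
      rcases h with (⟨rfl, rfl⟩ | ⟨rfl, rfl⟩) | h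
      · simp
      · simp
      · rw [(hL _ _).2 (Adj.reachable ((fromEdgeSet_adj _).2 ⟨h, hne⟩))]

lemma IsLabelling.numComp_eq {L : List ℕ} {S : Finset (Sym2 (Fin 8))} (h : IsLabelling L S) :
    numComp S = L.dedup.length := by
  obtain ⟨hlen, hL⟩ := h
  let f : (fromEdgeSet (S : Set (Sym2 (Fin 8)))).ConnectedComponent → L.toFinset :=
    ConnectedComponent.lift (fun u => ⟨L[u]'(u.2.trans_eq hlen.symm), by simp⟩) fun u v p _ => by
      have := (hL u v).2 p.reachable
      simpa [List.getD_eq_getElem?_getD, hlen] using this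
  have hf : Function.Bijective f := by
    constructor
    · refine ConnectedComponent.ind₂ fun u v huv => ConnectedComponent.sound ((hL u v).1 ?_)
      simpa [f, List.getD_eq_getElem?_getD, hlen] using huv
    · rintro ⟨c, hc⟩
      obtain ⟨i, hi, rfl⟩ := List.getElem_of_mem (List.mem_toFinset.1 hc)
      exact ⟨connectedComponentMk _ ⟨i, hi.trans_eq hlen⟩, rfl⟩
  rw [numComp, Nat.card_congr (Equiv.ofBijective f hf), Nat.card_eq_fintype_card,
    Fintype.card_coe, List.card_toFinset]

/-- Increase the multiplicity of the key `(c, m)` by `k`. -/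
def bump (c m k : ℕ) : List (ℕ × ℕ × ℕ) → List (ℕ × ℕ × ℕ)
  | [] => [(c, m, k)]
  | (c', m', k') :: T =>
    if c = c' ∧ m = m' then (c', m', k' + k) :: T else (c', m', k') :: bump c m k T

/-- The table of pairs (number of components, number of edges) with their multiplicities over
all subsets of the edges `l`, starting from the labels `L` and an initial number `m` of edges. -/
def tally : List (Fin n × Fin n) → List ℕ → ℕ → List (ℕ × ℕ × ℕ)
  | [], L, m => [(L.dedup.length, m, 1)]
  | e :: l, L, m =>
    (tally l L m).foldr (fun t T => bump t.1 t.2.1 t.2.2 T) (tally l (merge L e) (m + 1))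

variable {R : Type*} [CommSemiring R]

/-- The sum of `g` over the entries of a table, counted with multiplicity. -/
def tableSum (g : ℕ → ℕ → R) (T : List (ℕ × ℕ × ℕ)) : R :=
  (T.map fun t => (t.2.2 : R) * g t.1 t.2.1).sum

lemma tableSum_bump (g : ℕ → ℕ → R) (c m k : ℕ) (T : List (ℕ × ℕ × ℕ)) :
    tableSum g (bump c m k T) = k * g c m + tableSum g T := by
  induction T with
  | nil => simp [bump, tableSum]
  | cons t T ih =>
    obtain ⟨c', m', k'⟩ := t
    simp only [tableSum] at ih
    rw [bump]
    split_ifs with h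
    · obtain ⟨rfl, rfl⟩ := h
      simp only [tableSum, List.map_cons, List.sum_cons]
      push_cast
      ring
    · simp only [tableSum, List.map_cons, List.sum_cons, ih]
      ring

lemma tableSum_foldr_bump (g : ℕ → ℕ → R) (T T' : List (ℕ × ℕ × ℕ)) :
    tableSum g (T.foldr (fun t T => bump t.1 t.2.1 t.2.2 T) T') =
      tableSum g T + tableSum g T' := by
  induction T with
  | nil => simp [tableSum]
  | cons t T ih =>
    rw [List.foldr_cons, tableSum_bump, ih, ← add_assoc]
    simp [tableSum]

lemma tableSum_tally (g : ℕ → ℕ → R) (l : List (Fin 8 × Fin 8))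
    (hl : (l.map fun e => s(e.1, e.2)).Nodup) {L : List ℕ} {S₀ : Finset (Sym2 (Fin 8))}
    (hL : IsLabelling L S₀) (m : ℕ) :
    tableSum g (tally l L m) =
      ∑ S ∈ (l.map fun e => s(e.1, e.2)).toFinset.powerset, g (numComp (S ∪ S₀)) (S.card + m) := by
  induction l generalizing L S₀ m with
  | nil => simp [tally, tableSum, hL.numComp_eq]
  | cons e l ih =>
    rw [List.map_cons, List.nodup_cons] at hl
    have he : s(e.1, e.2) ∉ (l.map fun e => s(e.1, e.2)).toFinset := by
      simpa only [List.mem_toFinset] using hl.1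
    rw [tally, tableSum_foldr_bump, ih hl.2 (hL.merge e), ih hl.2 hL, List.map_cons,
      List.toFinset_cons, sum_powerset_insert he]
    congr 1
    refine sum_congr rfl fun S hS => ?_
    rw [card_insert_of_notMem fun h => he (mem_powerset.1 hS h), insert_union, union_insert,
      add_right_comm, add_assoc]

lemma isLabelling_foldr (l : List (Fin n × Fin n)) :
    IsLabelling (l.foldr (fun e L => merge L e) (List.range n))
      (l.map fun e => s(e.1, e.2)).toFinset := by
  induction l with
  | nil => exact isLabelling_range
  | cons e l ih => simpa using ih.merge e

end SpanningSubgraph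

open SpanningSubgraph

/-- The edges of `G₁` as a list of pairs. -/
def edgeList₁ : List (Fin 8 × Fin 8) :=
  [(0, 6), (0, 1), (1, 2), (2, 3), (3, 4), (4, 5), (5, 6), (6, 7), (1, 7), (1, 4), (4, 7)]

lemma toFinset_edgeList₁ : (edgeList₁.map fun e => s(e.1, e.2)).toFinset = E1 := by
  decide

lemma rk_E1 : rk E1 = 7 := by
  rw [rk, ← toFinset_edgeList₁, (isLabelling_foldr edgeList₁).numComp_eq]
  decide

lemma tally_edgeList₁ : tally edgeList₁ (List.range 8) 0 =
    [(1, 11, 1), (1, 10, 11), (1, 9, 50), (1, 8, 117), (2, 8, 47), (2, 7, 186), (2, 6, 324),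
      (1, 7, 125), (2, 9, 5), (3, 6, 135), (3, 5, 409), (4, 4, 319), (3, 7, 19), (4, 5, 53),
      (5, 3, 164), (6, 2, 55), (5, 4, 11), (4, 6, 3), (3, 8, 1), (7, 1, 11), (6, 3, 1),
      (8, 0, 1)] := by
  decide +kernel

/-- The Tutte polynomial of the first Schwärzler graph `G₁` equals the stated
polynomial in `ℚ[x,y]` (with `x = X 0`, `y = X 1`). -/
theorem tutte_G1 :
    (∑ S ∈ E1.powerset,
        (X 0 - 1 : MvPolynomial (Fin 2) ℚ) ^ (rk E1 - rk S) * (X 1 - 1) ^ (S.card - rk S)) =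
      X 0 ^ 7 + 4 * X 0 ^ 6 + X 0 ^ 5 * X 1 + 9 * X 0 ^ 5 + 6 * X 0 ^ 4 * X 1
        + 3 * X 0 ^ 3 * X 1 ^ 2 + X 0 ^ 2 * X 1 ^ 3 + 13 * X 0 ^ 4 + 13 * X 0 ^ 3 * X 1
        + 7 * X 0 ^ 2 * X 1 ^ 2 + 3 * X 0 * X 1 ^ 3 + X 1 ^ 4 + 12 * X 0 ^ 3
        + 15 * X 0 ^ 2 * X 1 + 9 * X 0 * X 1 ^ 2 + 3 * X 1 ^ 3 + 7 * X 0 ^ 2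
        + 9 * X 0 * X 1 + 4 * X 1 ^ 2 + 2 * X 0 + 2 * X 1 := by
  have h := tableSum_tally
    (fun c m => (X 0 - 1 : MvPolynomial (Fin 2) ℚ) ^ (7 - (8 - c)) * (X 1 - 1) ^ (m - (8 - c)))
    edgeList₁ (by decide) isLabelling_range 0
  simp only [toFinset_edgeList₁, union_empty, add_zero, tally_edgeList₁] at h
  simp only [rk_E1]
  simp only [rk]
  rw [← h]
  simp only [tableSum, List.map_cons, List.map_nil, List.sum_cons, List.sum_nil]
  norm_num
  ring
end

section
/- Let G₂ be the simple graph on vertex set {1,…,8} with edge set E₂ = {{1,7},{1,2},{2,4},{4,5},{5,7},{7,8},{2,8},{2,5},{3,5},{3,6},{6,8}}. For a subset S ⊆ E₂, let r(S) = 8 − c(S), where c(S) is the number of connected components of the spanning subgraph (V,S). Then the Tutte polynomial T_{G₂}(x,y) = Σ_{S ⊆ E₂} (x−1)^{r(E₂)−r(S)} (y−1)^{|S|−r(S)} equals x⁷ + 4x⁶ + x⁵y + 9x⁵ + 6x⁴y + 3x³y² + x²y³ + 13x⁴ + 13x³y + 7x²y² + 3xy³ + y⁴ + 12x³ + 15x²y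 + 9xy² + 3y³ + 7x² + 9xy + 4y² + 2x + 2y as a polynomial in ℚ[x,y] (equivalently ℤ[x,y]). -/
open Finset SimpleGraph MvPolynomial

/-- The list `l` of vertex labels describes the partition of `Fin n` into the connected components
of the graph with edge set `S`. -/
def IsLabelling {n : ℕ} (l : List ℕ) (S : Finset (Sym2 (Fin n))) : Prop :=
  l.length = n ∧ ∀ v w : Fin n, l.getD v 0 = l.getD w 0 ↔
    (fromEdgeSet (S : Set (Sym2 (Fin n)))).Reachable v w

/-- Relabel the component of `a` by the label of `b`. -/
def mergeLabels (l : List ℕ) (a b : ℕ) : List ℕ :=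
  l.map fun x => if x = l.getD a 0 then l.getD b 0 else x

/-- Record `n` further occurrences of `p` in a table of multiplicities. -/
def addEntry (p : ℕ × ℕ) (n : ℕ) : List ((ℕ × ℕ) × ℕ) → List ((ℕ × ℕ) × ℕ)
  | [] => [(p, n)]
  | t :: ts => if p = t.1 then (p, n + t.2) :: ts else t :: addEntry p n ts

/-- The pairs (rank, cardinality), with multiplicities, of the edge sets obtained by adding some of
the listed edges to a set of `c` edges whose components are labelled by `l`. -/
def rankCardTable : List (Fin 8 × Fin 8) → List ℕ → ℕ → List ((ℕ × ℕ) × ℕ)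
  | [], l, c => [((8 - l.dedup.length, c), 1)]
  | e :: es, l, c =>
    (rankCardTable es l c).foldr (fun t => addEntry t.1 t.2)
      (rankCardTable es (mergeLabels l e.1 e.2) (c + 1))

theorem sum_map_addEntry {M : Type*} [AddCommMonoid M] (f : ℕ × ℕ → M) (p : ℕ × ℕ) (n : ℕ)
    (ts : List ((ℕ × ℕ) × ℕ)) :
    ((addEntry p n ts).map fun t => t.2 • f t.1).sum =
      n • f p + (ts.map fun t => t.2 • f t.1).sum := by
  induction ts with
  | nil => simp [addEntry]
  | cons t ts ih =>
    rw [addEntry]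
    split_ifs with h
    · simp [h, add_smul, add_assoc]
    · simp [ih, add_left_comm]

theorem sum_map_foldr_addEntry {M : Type*} [AddCommMonoid M] (f : ℕ × ℕ → M)
    (ts us : List ((ℕ × ℕ) × ℕ)) :
    ((ts.foldr (fun t => addEntry t.1 t.2) us).map fun t => t.2 • f t.1).sum =
      (ts.map fun t => t.2 • f t.1).sum + (us.map fun t => t.2 • f t.1).sum := by
  induction ts with
  | nil => simp
  | cons t ts ih => simp [sum_map_addEntry, ih, add_assoc]

theorem isLabelling_range (n : ℕ) :
    IsLabelling (List.range n) (∅ : Finset (Sym2 (Fin n))) := by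
  refine ⟨List.length_range, fun v w => ?_⟩
  simp [List.getD_eq_getElem?_getD, Fin.ext_iff]

theorem getD_mergeLabels {l : List ℕ} {v : ℕ} (hv : v < l.length) (a b : ℕ) :
    (mergeLabels l a b).getD v 0 =
      if l.getD v 0 = l.getD a 0 then l.getD b 0 else l.getD v 0 := by
  simp [mergeLabels, List.getD_eq_getElem?_getD, hv]

theorem IsLabelling.insert {n : ℕ} {l : List ℕ} {S : Finset (Sym2 (Fin n))}
    (h : IsLabelling l S) (a b : Fin n) :
    IsLabelling (mergeLabels l a b) (insert s(a, b) S) := by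
  obtain ⟨hl, h⟩ := h
  refine ⟨by simp [mergeLabels, hl], fun v w => ?_⟩
  have key (v : Fin n) := getD_mergeLabels (v.isLt.trans_eq hl.symm) (a : ℕ) b
  have hle : fromEdgeSet (S : Set (Sym2 (Fin n))) ≤ fromEdgeSet ↑(Insert.insert s(a, b) S) :=
    fromEdgeSet_mono (by simp)
  have mono {v w : Fin n} (hvw : l.getD v 0 = l.getD w 0) := ((h v w).1 hvw).mono hle
  have hab : (fromEdgeSet (↑(Insert.insert s(a, b) S) : Set (Sym2 (Fin n)))).Reachable a b := by
    rcases eq_or_ne a b with rfl | hne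
    · rfl
    · exact Adj.reachable (by simp [hne])
  constructor
  · intro hvw
    rw [key v, key w] at hvw
    split_ifs at hvw with hv hw hw
    · exact mono (hv.trans hw.symm)
    · exact (mono hv).trans (hab.trans (mono hvw))
    · exact (mono hvw).trans (hab.symm.trans (mono hw.symm))
    · exact mono hvw
  · rintro ⟨p⟩
    induction p with
    | nil => rfl
    | @cons u v w huv p ih =>
      refine Eq.trans ?_ ih
      rw [fromEdgeSet_adj] at huv
      rw [key u, key v]
      rcases Finset.mem_insert.1 (Finset.mem_coe.1 huv.1) with he | he
      · rcases Sym2.eq_iff.1 he with ⟨rfl, rfl⟩ | ⟨rfl, rfl⟩ <;> simp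
      · rw [(h u v).2 (Adj.reachable ((fromEdgeSet_adj _).2 ⟨he, huv.2⟩))]

theorem IsLabelling.rk_eq {l : List ℕ} {S : Finset (Sym2 (Fin 8))} (h : IsLabelling l S) :
    rk S = 8 - l.dedup.length := by
  classical
  obtain ⟨hl, h⟩ := h
  let f : (fromEdgeSet (S : Set (Sym2 (Fin 8)))).ConnectedComponent → ℕ :=
    Quot.lift (fun v => l.getD v 0) fun v w hvw => (h v w).2 hvw
  have hf : Function.Injective f := by
    rintro ⟨v⟩ ⟨w⟩ hvw
    exact ConnectedComponent.sound ((h v w).1 hvw)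
  have hrange : Set.range f = l.toFinset := by
    ext x
    simp only [Set.mem_range, Finset.mem_coe, List.mem_toFinset, List.mem_iff_getElem]
    constructor
    · rintro ⟨⟨v⟩, rfl⟩
      exact ⟨v, v.isLt.trans_eq hl.symm, (List.getD_eq_getElem _ _ _).symm⟩
    · rintro ⟨i, hi, rfl⟩
      exact ⟨Quot.mk _ ⟨i, hi.trans_eq hl⟩, List.getD_eq_getElem _ _ _⟩
  rw [rk, numComp, ← Nat.card_range_of_injective hf, hrange, ← List.card_toFinset,
    Nat.card_coe_set_eq, Set.ncard_coe_finset]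

theorem sum_powerset_eq_sum_rankCardTable {M : Type*} [AddCommMonoid M] (f : ℕ × ℕ → M)
    (es : List (Fin 8 × Fin 8)) {l : List ℕ} {S : Finset (Sym2 (Fin 8))} (h : IsLabelling l S)
    (hes : (es.map fun e => s(e.1, e.2)).Nodup)
    (hS : Disjoint S (es.map fun e => s(e.1, e.2)).toFinset) :
    ∑ T ∈ (es.map fun e => s(e.1, e.2)).toFinset.powerset, f (rk (S ∪ T), #(S ∪ T)) =
      ((rankCardTable es l #S).map fun t => t.2 • f t.1).sum := by
  induction es generalizing l S with
  | nil => simp [rankCardTable, h.rk_eq]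
  | cons e es ih =>
    simp only [List.map_cons, List.nodup_cons, List.toFinset_cons, ← List.mem_toFinset,
      Finset.disjoint_insert_right] at hes hS ⊢
    rw [Finset.sum_powerset_insert (by simpa using hes.1), rankCardTable,
      sum_map_foldr_addEntry, ih h hes.2 hS.2, ← Finset.card_insert_of_notMem hS.1,
      ← ih (h.insert e.1 e.2) hes.2 (Finset.disjoint_insert_left.2 ⟨hes.1, hS.2⟩)]
    simp only [Finset.union_insert, Finset.insert_union]

/-- The edges of `G₂` as ordered pairs. -/
def edgeList2 : List (Fin 8 × Fin 8) :=
  [(0,6), (0,1), (1,3), (3,4), (4,6), (6,7), (1,7), (1,4), (2,4), (2,5), (5,7)]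

theorem toFinset_edgeList2 : (edgeList2.map fun e => s(e.1, e.2)).toFinset = E2 := by
  decide

/-- The pairs (rank, cardinality) realised by edge sets of `G₂`, each with the number of edge sets
realising it. -/
def rankCardTable2 : List ((ℕ × ℕ) × ℕ) :=
  [((7,11),1), ((7,10),11), ((6,9),5), ((5,8),1), ((5,7),19), ((6,8),47), ((7,9),50),
   ((7,8),117), ((6,7),186), ((5,6),135), ((4,6),3), ((4,5),53), ((4,4),319), ((5,5),409),
   ((6,6),324), ((7,7),125), ((3,3),164), ((3,4),11), ((2,2),55), ((1,1),11), ((2,3),1),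
   ((0,0),1)]

theorem rankCardTable_edgeList2 :
    rankCardTable edgeList2 (List.range 8) 0 = rankCardTable2 := by
  decide +kernel

theorem sum_powerset_E2 {M : Type*} [AddCommMonoid M] (f : ℕ × ℕ → M) :
    ∑ S ∈ E2.powerset, f (rk S, #S) = (rankCardTable2.map fun t => t.2 • f t.1).sum := by
  have h := sum_powerset_eq_sum_rankCardTable f edgeList2 (isLabelling_range 8) (by decide)
    (Finset.disjoint_empty_left _)
  simpa only [toFinset_edgeList2, Finset.empty_union, Finset.card_empty,
    rankCardTable_edgeList2] using h

theorem rk_E2 : rk E2 = 7 := by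
  have h : ∀ (es : List (Fin 8 × Fin 8)) {l S}, IsLabelling l S →
      IsLabelling (es.foldl (fun l e => mergeLabels l e.1 e.2) l)
        (es.foldl (fun S e => insert s(e.1, e.2) S) S) := by
    intro es
    induction es with
    | nil => exact fun h => h
    | cons e es ih => exact fun h => ih (h.insert e.1 e.2)
  have hE : edgeList2.foldl (fun S e => insert s(e.1, e.2) S) ∅ = E2 := by decide
  rw [← hE, (h edgeList2 (isLabelling_range 8)).rk_eq]
  decide

/-- The Tutte polynomial of the second Schwärzler graph `G₂` equals the stated
polynomial in `ℚ[x,y]` (with `x = X 0`, `y = X 1`). -/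
theorem tutte_G2 :
    (∑ S ∈ E2.powerset,
        (X 0 - 1 : MvPolynomial (Fin 2) ℚ) ^ (rk E2 - rk S) * (X 1 - 1) ^ (S.card - rk S)) =
      X 0 ^ 7 + 4 * X 0 ^ 6 + X 0 ^ 5 * X 1 + 9 * X 0 ^ 5 + 6 * X 0 ^ 4 * X 1
        + 3 * X 0 ^ 3 * X 1 ^ 2 + X 0 ^ 2 * X 1 ^ 3 + 13 * X 0 ^ 4 + 13 * X 0 ^ 3 * X 1
        + 7 * X 0 ^ 2 * X 1 ^ 2 + 3 * X 0 * X 1 ^ 3 + X 1 ^ 4 + 12 * X 0 ^ 3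
        + 15 * X 0 ^ 2 * X 1 + 9 * X 0 * X 1 ^ 2 + 3 * X 1 ^ 3 + 7 * X 0 ^ 2
        + 9 * X 0 * X 1 + 4 * X 1 ^ 2 + 2 * X 0 + 2 * X 1 := by
  rw [rk_E2, sum_powerset_E2 fun p =>
    (X 0 - 1 : MvPolynomial (Fin 2) ℚ) ^ (7 - p.1) * (X 1 - 1) ^ (p.2 - p.1)]
  simp only [rankCardTable2, List.map_cons, List.map_nil, List.sum_cons, List.sum_nil,
    nsmul_eq_mul]
  ring
end

section
/- Let G₁ be the simple graph on vertex set {1,…,8} with edge set E₁ = {{1,7},{1,2},{2,3},{3,4},{4,5},{5,6},{6,7},{7,8},{2,8},{2,5},{5,8}}, and let G₂ be the simple graph on the same vertex set with edge set E₂ = {{1,7},{1,2},{2,4},{4,5},{5,7},{7,8},{2,8},{2,5},{3,5},{3,6},{6,8}}. Then G₁ and G₂ have the same number of spanning trees: the number of subsets S ⊆ E₁ with |S| = 7 such that the spanning subgraph ({1,…,8},S) is connected equals the number of subsets S ⊆ E₂ with |S| = 7 such that the spanning subgraph ({1,…,8},S) is connected, and this common number is 125. -/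
open Finset SimpleGraph MvPolynomial

namespace List

variable {V W : Type*} [DecidableEq W]

/-- Relabel `v` so that the class of `e.1` is absorbed into the class of `e.2`. -/
def mergeLabels (c : V → W) (e : V × V) : V → W :=
  fun v => if c v = c e.1 then c e.2 else c v

lemma mergeLabels_eq_of_eq {c : V → W} (e : V × V) {u v : V} (h : c u = c v) :
    mergeLabels c e u = mergeLabels c e v := by
  simp [mergeLabels, h]

lemma mergeLabels_fst_eq_snd (c : V → W) (e : V × V) :
    mergeLabels c e e.1 = mergeLabels c e e.2 := by
  simp [mergeLabels]

lemma eqvGen_of_mergeLabels_eq {c : V → W} {e : V × V} {r : V → V → Prop}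
    (hr : ∀ u v, c u = c v → Relation.EqvGen r u v) (he : Relation.EqvGen r e.1 e.2)
    {u v : V} (h : mergeLabels c e u = mergeLabels c e v) : Relation.EqvGen r u v := by
  unfold mergeLabels at h
  split_ifs at h with hu hv hv
  · exact hr _ _ (hu.trans hv.symm)
  · exact ((hr _ _ hu).trans _ _ _ he).trans _ _ _ (hr _ _ h)
  · exact ((hr _ _ h).trans _ _ _ (he.symm _ _)).trans _ _ _ (hr _ _ hv.symm)
  · exact hr _ _ h

lemma foldl_mergeLabels_eq_iff (l : List (V × V)) (c : V → W) (u v : V) :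
    l.foldl mergeLabels c u = l.foldl mergeLabels c v ↔
      Relation.EqvGen (fun x y => c x = c y ∨ (x, y) ∈ l) u v := by
  induction l generalizing c with
  | nil =>
    have h : Equivalence fun x y => c x = c y :=
      ⟨fun _ => rfl, fun h => h.symm, fun h h' => h.trans h'⟩
    simp [h.eqvGen_iff]
  | cons e l ih =>
    rw [foldl_cons, ih]
    constructor
    · refine Relation.EqvGen.rec ?_ (fun _ => .refl _) (fun _ _ _ h => .symm _ _ h)
        (fun _ _ _ _ _ h h' => .trans _ _ _ h h')
      rintro x y (h | h)
      · exact eqvGen_of_mergeLabels_eq (fun _ _ h => .rel _ _ (.inl h))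
          (.rel _ _ (.inr mem_cons_self)) h
      · exact .rel _ _ (.inr (mem_cons_of_mem _ h))
    · refine Relation.EqvGen.mono (fun x y h => ?_) u v
      rcases h with h | h
      · exact .inl (mergeLabels_eq_of_eq e h)
      · rcases mem_cons.1 h with rfl | h
        · exact .inl (mergeLabels_fst_eq_snd c (x, y))
        · exact .inr h

/-- Vertices get the same label exactly when they are joined by a walk along the listed edges. -/
lemma foldl_mergeLabels_eq_iff_reachable (l : List (V × V)) {c : V → W}
    (hc : c.Injective) (u v : V) :
    l.foldl mergeLabels c u = l.foldl mergeLabels c v ↔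
      (SimpleGraph.fromEdgeSet {e | e ∈ l.map fun p => s(p.1, p.2)}).Reachable u v := by
  rw [foldl_mergeLabels_eq_iff]
  constructor
  · refine Relation.EqvGen.rec ?_ (fun _ => .rfl) (fun _ _ _ h => h.symm)
      (fun _ _ _ _ _ h h' => h.trans h')
    rintro x y (h | h)
    · rw [hc h]
    · by_cases hxy : x = y
      · rw [hxy]
      · exact SimpleGraph.Adj.reachable
          ((SimpleGraph.fromEdgeSet_adj _).2 ⟨mem_map.2 ⟨_, h, rfl⟩, hxy⟩)
  · rintro ⟨w⟩
    induction w with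
    | nil => exact .refl _
    | cons h _ ih =>
      refine .trans _ _ _ ?_ ih
      obtain ⟨p, hp, h⟩ := mem_map.1 ((SimpleGraph.fromEdgeSet_adj _).1 h).1
      rcases Sym2.eq_iff.1 h with ⟨rfl, rfl⟩ | ⟨rfl, rfl⟩
      · exact .rel _ _ (.inr hp)
      · exact .symm _ _ (.rel _ _ (.inr hp))

lemma connected_fromEdgeSet_iff (l : List (V × V)) {c : V → W} (hc : c.Injective) (r : V) :
    (SimpleGraph.fromEdgeSet {e | e ∈ l.map fun p => s(p.1, p.2)}).Connected ↔
      ∀ v, l.foldl mergeLabels c v = l.foldl mergeLabels c r := by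
  simp only [foldl_mergeLabels_eq_iff_reachable _ hc]
  exact ⟨fun h v => h v r, fun h => (SimpleGraph.connected_iff _).2
    ⟨fun u v => (h u).trans (h v).symm, ⟨r⟩⟩⟩

end List

lemma Finset.card_filter_powerset_toFinset {α : Type*} [DecidableEq α] (l : List α)
    (hl : l.Nodup) (k : ℕ) (P : Finset α → Prop) [DecidablePred P] :
    (l.toFinset.powerset.filter fun S => S.card = k ∧ P S).card =
      (l.sublistsLen k).countP fun m => P m.toFinset := by
  calc
    _ = ((l.toFinset.powersetCard k).val.map Finset.val).countP fun m => P m.toFinset := by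
      rw [← Finset.filter_filter, ← Finset.powersetCard_eq_filter, Multiset.countP_map]
      simp [Finset.card_def]
    _ = _ := by
      rw [Finset.map_val_val_powersetCard, List.toFinset_val, hl.dedup,
        Multiset.powersetCard_coe, Multiset.coe_countP, List.countP_map]
      rfl

lemma List.sublistsLen_map {α β : Type*} (f : α → β) (k : ℕ) (l : List α) :
    (l.map f).sublistsLen k = (l.sublistsLen k).map (List.map f) := by
  induction l generalizing k with
  | nil => cases k <;> simp
  | cons a l ih => cases k <;> simp [ih, List.sublistsLen_succ_cons, Function.comp_def]

/-- The number of connected spanning subgraphs with `k` edges, as a computable count over the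
sublists of an edge list. -/
lemma card_connected_spanning_eq_countP {V W : Type*} [Fintype V] [DecidableEq V]
    [DecidableEq W] {c : V → W} (hc : c.Injective)
    (l : List (V × V)) (hl : (l.map fun p => s(p.1, p.2)).Nodup) (k : ℕ) (r : V)
    [DecidablePred fun S : Finset (Sym2 V) =>
      (SimpleGraph.fromEdgeSet (S : Set (Sym2 V))).Connected] :
    ((l.map fun p => s(p.1, p.2)).toFinset.powerset.filter fun S : Finset (Sym2 V) =>
        S.card = k ∧ (SimpleGraph.fromEdgeSet (S : Set (Sym2 V))).Connected).card =
      (l.sublistsLen k).countP fun m =>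
        ∀ v, m.foldl List.mergeLabels c v = m.foldl List.mergeLabels c r := by
  rw [Finset.card_filter_powerset_toFinset _ hl, List.sublistsLen_map, List.countP_map]
  refine List.countP_congr fun m _ => ?_
  simp only [Function.comp_apply, decide_eq_true_eq, List.coe_toFinset,
    List.connected_fromEdgeSet_iff m hc r]

/-- The two Schwärzler graphs have the same number of spanning trees, namely `125`. -/
theorem spanning_trees_eq :
    (E1.powerset.filter (fun (S : Finset (Sym2 (Fin 8))) => S.card = 7 ∧
        (SimpleGraph.fromEdgeSet (↑S : Set (Sym2 (Fin 8)))).Connected)).card =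
    (E2.powerset.filter (fun (S : Finset (Sym2 (Fin 8))) => S.card = 7 ∧
        (SimpleGraph.fromEdgeSet (↑S : Set (Sym2 (Fin 8)))).Connected)).card ∧
    (E1.powerset.filter (fun (S : Finset (Sym2 (Fin 8))) => S.card = 7 ∧
        (SimpleGraph.fromEdgeSet (↑S : Set (Sym2 (Fin 8)))).Connected)).card = 125 := by
  have h1 := card_connected_spanning_eq_countP Fin.val_injective
    [((0 : Fin 8), (6 : Fin 8)), (0, 1), (1, 2), (2, 3), (3, 4), (4, 5), (5, 6), (6, 7), (1, 7),
      (1, 4), (4, 7)] (by decide) 7 0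
  have h2 := card_connected_spanning_eq_countP Fin.val_injective
    [((0 : Fin 8), (6 : Fin 8)), (0, 1), (1, 3), (3, 4), (4, 6), (6, 7), (1, 7), (1, 4), (2, 4),
      (2, 5), (5, 7)] (by decide) 7 0
  replace h1 := h1.trans (show _ = 125 by decide +kernel)
  replace h2 := h2.trans (show _ = 125 by decide +kernel)
  exact ⟨h1.trans h2.symm, h1⟩
end
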